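/- The presented group on three generators x₁, x₂, x₃ with relators x₁^2, x₂*u*x₃*u⁻¹ where u = x₃⁻¹*x₂, and x₁*v*x₂*v⁻¹ where v = x₃*x₂⁻¹*x₃⁻¹*x₂*x₃⁻¹*x₁, is isomorphic to the Coxeter group W(3,3,∞), i.e. to the presented group on generators x₁, x₂, x₃ with relators x₁^2, x₂^2, x₃^2, (x₁*x₂)^3, (x₂*x₃)^3. (This is the fundamental group computation for τ_{R(D(3₁#3₁#3₁*#3₁*))} in Proposition 4.17 and Remark 4.18.) -/

import Mathlib

/-- The generator `x₁` of the free group on three generators. -/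
def x1 : FreeGroup (Fin 3) := FreeGroup.of 0

/-- The generator `x₂` of the free group on three generators. -/
def x2 : FreeGroup (Fin 3) := FreeGroup.of 1

/-- The generator `x₃` of the free group on three generators. -/
def x3 : FreeGroup (Fin 3) := FreeGroup.of 2

/-- The relators of the Coxeter group `W(3,3,∞)`:
`x₁², x₂², x₃², (x₁x₂)³, (x₂x₃)³`. -/
def W33InfRels : Set (FreeGroup (Fin 3)) :=
  {x1 ^ 2, x2 ^ 2, x3 ^ 2, (x1 * x2) ^ 3, (x2 * x3) ^ 3}

/-- The word `u = x₃⁻¹x₂`. -/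
def u : FreeGroup (Fin 3) := x3⁻¹ * x2

/-- The word `v = x₃x₂⁻¹x₃⁻¹x₂x₃⁻¹x₁`. -/
def v : FreeGroup (Fin 3) := x3 * x2⁻¹ * x3⁻¹ * x2 * x3⁻¹ * x1

/-- The τ-presentation relators of `π₁(τ_{R(D(3₁#3₁#3₁*#3₁*))})`. -/
def rels11 : Set (FreeGroup (Fin 3)) :=
  {x1 ^ 2, x2 * u * x3 * u⁻¹, x1 * v * x2 * v⁻¹}

/-- The relations of `rels11` and those of `W(3,3,∞)` are equivalent in every group. -/
theorem tau_relations_iff_coxeter_relations {G : Type*} [Group G] (a b c : G) :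
    (a ^ 2 = 1 ∧ b * (c⁻¹ * b) * c * (c⁻¹ * b)⁻¹ = 1 ∧
      a * (c * b⁻¹ * c⁻¹ * b * c⁻¹ * a) * b * (c * b⁻¹ * c⁻¹ * b * c⁻¹ * a)⁻¹ = 1) ↔
    (a ^ 2 = 1 ∧ b ^ 2 = 1 ∧ c ^ 2 = 1 ∧ (a * b) ^ 3 = 1 ∧ (b * c) ^ 3 = 1) := by
  refine and_congr_right fun ha => ?_
  have sq_eq_one_of_conj (g x y : G) (hy : y ^ 2 = 1) (h : y * g * x * g⁻¹ = 1) :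
      x ^ 2 = 1 := by
    have hx : x = g⁻¹ * y⁻¹ * g⁻¹⁻¹ := by
      rw [← mul_one (g⁻¹ * y⁻¹), ← h]
      group
    rw [hx, conj_pow, inv_pow, hy]
    group
  have ha' : a⁻¹ = a := inv_eq_of_mul_eq_one_left (by rw [← sq, ha])
  have key (hb : b ^ 2 = 1) (hc : c ^ 2 = 1) :
      (b * (c⁻¹ * b) * c * (c⁻¹ * b)⁻¹ = 1 ∧
        a * (c * b⁻¹ * c⁻¹ * b * c⁻¹ * a) * b * (c * b⁻¹ * c⁻¹ * b * c⁻¹ * a)⁻¹ = 1) ↔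
      ((a * b) ^ 3 = 1 ∧ (b * c) ^ 3 = 1) := by
    have hb' : b⁻¹ = b := inv_eq_of_mul_eq_one_left (by rw [← sq, hb])
    have hc' : c⁻¹ = c := inv_eq_of_mul_eq_one_left (by rw [← sq, hc])
    have hu : b * (c⁻¹ * b) * c * (c⁻¹ * b)⁻¹ = (b * c) ^ 3 := by
      simp only [mul_inv_rev, hb', hc', pow_succ, pow_zero, one_mul, mul_assoc]
    rw [hu, and_comm]
    refine and_congr_left fun hbc => ?_
    have hv : c * b⁻¹ * c⁻¹ * b * c⁻¹ = b := by
      have h : b * (c * b⁻¹ * c⁻¹ * b * c⁻¹) = 1 := by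
        rw [← hbc, hb', hc']
        simp only [pow_succ, pow_zero, one_mul, mul_assoc]
      rw [eq_inv_of_mul_eq_one_right h, hb']
    rw [hv, mul_inv_rev, ha', hb']
    simp only [pow_succ, pow_zero, one_mul, mul_assoc]
  constructor
  · rintro ⟨h₁, h₂⟩
    have hb := sq_eq_one_of_conj _ b a ha h₂
    have hc := sq_eq_one_of_conj _ c b hb h₁
    exact ⟨hb, hc, (key hb hc).mp ⟨h₁, h₂⟩⟩
  · rintro ⟨hb, hc, h⟩
    exact (key hb hc).mpr h

/-- A homomorphism out of the free group kills `rels11` iff it kills `W33InfRels`. -/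
theorem forall_rels11_iff_forall_W33InfRels {G : Type*} [Group G] (f : FreeGroup (Fin 3) →* G) :
    (∀ r ∈ rels11, f r = 1) ↔ ∀ r ∈ W33InfRels, f r = 1 := by
  simpa [rels11, W33InfRels, u, v, mul_assoc] using
    tau_relations_iff_coxeter_relations (f x1) (f x2) (f x3)

theorem normalClosure_rels11 :
    Subgroup.normalClosure rels11 = Subgroup.normalClosure W33InfRels := by
  apply le_antisymm <;> refine Subgroup.normalClosure_le_normal fun r hr => ?_
  · exact (QuotientGroup.eq_one_iff r).mp
      ((forall_rels11_iff_forall_W33InfRels (PresentedGroup.mk W33InfRels)).mpr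
        (fun _ => PresentedGroup.one_of_mem) r hr)
  · exact (QuotientGroup.eq_one_iff r).mp
      ((forall_rels11_iff_forall_W33InfRels (PresentedGroup.mk rels11)).mp
        (fun _ => PresentedGroup.one_of_mem) r hr)

/-- The fundamental group of the Price twist `τ_{R(D(3₁#3₁#3₁*#3₁*))}` is isomorphic to
the Coxeter group `W(3,3,∞)`. -/
theorem stmt_11 : Nonempty (PresentedGroup rels11 ≃* PresentedGroup W33InfRels) := by
  exact ⟨QuotientGroup.quotientMulEquivOfEq normalClosure_rels11⟩
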